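/- Let a, b be nonzero complex numbers with |a| < 1 and let K ⊂ D be compact. Then there is a constant M = M(a,b,K) such that every injective holomorphic f : D → ℂ with f(0) = 0 and f(a) = b satisfies |f(z)| ≤ M for all z ∈ K. -/

import Mathlib

open Metric Set

open Filter Topology

/-- An injective holomorphic function is locally open. -/
lemma nhds_le_map_nhds_of_injOn {f : ℂ → ℂ} {U : Set ℂ} (hU : IsOpen U)
    (hf : DifferentiableOn ℂ f U) (hi : InjOn f U) {z : ℂ} (hz : z ∈ U) :
    𝓝 (f z) ≤ map f (𝓝 z) := by
  refine (hf.analyticAt (hU.mem_nhds hz)).eventually_constant_or_nhds_le_map_nhds.resolve_left ?_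
  intro h
  have h' : ∀ᶠ w in 𝓝[≠] z, False := by
    filter_upwards [h.filter_mono nhdsWithin_le_nhds,
      (hU.eventually_mem hz).filter_mono nhdsWithin_le_nhds, self_mem_nhdsWithin] with w h1 h2 h3
    exact h3 (hi h2 hz h1)
  exact h'.exists.elim fun _ hw ↦ hw

lemma isOpen_image_of_injOn {f : ℂ → ℂ} {U : Set ℂ} (hU : IsOpen U)
    (hf : DifferentiableOn ℂ f U) (hi : InjOn f U) : IsOpen (f '' U) := by
  rw [isOpen_iff_mem_nhds]
  rintro _ ⟨z, hz, rfl⟩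
  exact nhds_le_map_nhds_of_injOn hU hf hi hz (image_mem_map (hU.mem_nhds hz))

/-- The derivative of an injective holomorphic function has only isolated zeros. -/
lemma eventually_deriv_ne_zero_of_injOn {f : ℂ → ℂ} {U : Set ℂ} (hU : IsOpen U)
    (hf : DifferentiableOn ℂ f U) (hi : InjOn f U) {z : ℂ} (hz : z ∈ U) :
    ∀ᶠ w in 𝓝[≠] z, deriv f w ≠ 0 := by
  refine (hf.analyticAt (hU.mem_nhds hz)).deriv.eventually_eq_zero_or_eventually_ne_zero.resolve_left
    fun h ↦ ?_
  obtain ⟨ε, hε, hball⟩ := Metric.eventually_nhds_iff_ball.1 (h.and (hU.eventually_mem hz))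
  have hconst : ∀ w ∈ ball z ε, f w = f z := fun w hw ↦
    isOpen_ball.is_const_of_deriv_eq_zero (convex_ball z ε).isPreconnected
      (hf.mono fun y hy ↦ (hball y hy).2) (fun y hy ↦ (hball y hy).1) hw (mem_ball_self hε)
  have h' : ∀ᶠ w in 𝓝[≠] z, False := by
    filter_upwards [mem_nhdsWithin_of_mem_nhds (ball_mem_nhds z hε), self_mem_nhdsWithin] with w h1 h3
    exact h3 (hi (hball w h1).2 hz (hconst w h1))
  exact h'.exists.elim fun _ hw ↦ hw

/-- The inverse of an injective holomorphic function is holomorphic. -/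
lemma differentiableOn_invFunOn_of_injOn {f : ℂ → ℂ} {U : Set ℂ} (hU : IsOpen U)
    (hf : DifferentiableOn ℂ f U) (hi : InjOn f U) :
    DifferentiableOn ℂ (Function.invFunOn f U) (f '' U) := by
  set φ := Function.invFunOn f U
  have hleft : ∀ z ∈ U, φ (f z) = z := fun z hz ↦ hi.leftInvOn_invFunOn hz
  have hright : ∀ w ∈ f '' U, f (φ w) = w := fun w hw ↦ Function.invFunOn_eq hw
  have hV := isOpen_image_of_injOn hU hf hi
  have htend : ∀ z ∈ U, Tendsto φ (𝓝 (f z)) (𝓝 z) := by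
    intro z hz
    refine (tendsto_map'_iff.2 ?_).mono_left (nhds_le_map_nhds_of_injOn hU hf hi hz)
    refine tendsto_id.congr' ?_
    filter_upwards [hU.mem_nhds hz] with w hw using (hleft w hw).symm
  have hcont : ∀ w ∈ f '' U, ContinuousAt φ w := by
    rintro _ ⟨z, hz, rfl⟩
    simpa only [ContinuousAt, hleft z hz] using htend z hz
  rintro _ ⟨z, hz, rfl⟩
  refine (Complex.analyticAt_of_differentiable_on_punctured_nhds_of_continuousAt ?_
    (hcont _ (mem_image_of_mem f hz))).differentiableAt.differentiableWithinAt
  have hmem := hV.eventually_mem (mem_image_of_mem f hz)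
  have htend' : Tendsto φ (𝓝[≠] (f z)) (𝓝[≠] z) := by
    refine tendsto_nhdsWithin_iff.2 ⟨(htend z hz).mono_left nhdsWithin_le_nhds, ?_⟩
    filter_upwards [hmem.filter_mono nhdsWithin_le_nhds, self_mem_nhdsWithin] with w h1 h2 h3
    exact h2 (by rw [mem_singleton_iff, ← hright w h1, mem_singleton_iff.1 h3])
  filter_upwards [hmem.filter_mono nhdsWithin_le_nhds,
    htend'.eventually (eventually_deriv_ne_zero_of_injOn hU hf hi hz)] with w hw hd
  refine (HasDerivAt.of_local_left_inverse (hcont w hw)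
    (differentiableAt_of_deriv_ne_zero hd).hasDerivAt hd ?_).differentiableAt
  filter_upwards [hV.mem_nhds hw] with y hy using hright y hy

/-- A nonvanishing holomorphic function on the unit disc has a holomorphic logarithm. -/
lemma exists_differentiableOn_exp_eq {g : ℂ → ℂ} (hg : DifferentiableOn ℂ g (ball 0 1))
    (hg0 : ∀ z ∈ ball (0 : ℂ) 1, g z ≠ 0) (h1 : g 0 = 1) :
    ∃ L : ℂ → ℂ, DifferentiableOn ℂ L (ball 0 1) ∧ L 0 = 0 ∧
      ∀ z ∈ ball (0 : ℂ) 1, Complex.exp (L z) = g z := by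
  have hsc : IsSimplyConnected (ball (0 : ℂ) 1) := by
    have := (convex_ball (0 : ℂ) 1).contractibleSpace ⟨0, mem_ball_self one_pos⟩
    exact SimplyConnectedSpace.ofContractible _
  obtain ⟨L, hLc, hL⟩ := Complex.exists_continuousOn_eqOn_exp_comp hsc isOpen_ball hg.continuousOn
    (by rintro ⟨z, hz, h⟩; exact hg0 z hz h)
  replace hL : ∀ z ∈ ball (0 : ℂ) 1, Complex.exp (L z) = g z := fun z hz ↦ hL hz
  have hLd : DifferentiableOn ℂ L (ball 0 1) := by
    intro z hz
    have hLz := hLc.continuousAt (isOpen_ball.mem_nhds hz)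
    have hgz := hg.differentiableAt (isOpen_ball.mem_nhds hz)
    have hlog : DifferentiableAt ℂ (fun w ↦ L z + Complex.log (g w / g z)) z := by
      refine ((hgz.div_const _).clog ?_).const_add _
      simp [div_self (hg0 z hz)]
    refine (hlog.congr_of_eventuallyEq ?_).differentiableWithinAt
    have him : Tendsto (fun w ↦ (L w - L z).im) (𝓝 z) (𝓝 0) := by
      have : ContinuousAt (fun w ↦ (L w - L z).im) z :=
        Complex.continuous_im.continuousAt.comp (hLz.sub continuousAt_const)
      simpa [ContinuousAt] using this
    filter_upwards [isOpen_ball.mem_nhds hz,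
      him.eventually (Ioo_mem_nhds (neg_lt_zero.2 Real.pi_pos) Real.pi_pos)] with w hw hwi
    rw [← hL w hw, ← hL z hz, ← Complex.exp_sub, Complex.log_exp hwi.1 hwi.2.le]
    ring
  have h0 : (0 : ℂ) ∈ ball (0 : ℂ) 1 := mem_ball_self one_pos
  refine ⟨fun z ↦ L z - L 0, hLd.sub_const _, by simp, fun z hz ↦ ?_⟩
  rw [Complex.exp_sub, hL z hz, hL 0 h0, h1, div_one]

/-- Growth bound for holomorphic functions on the disc normalized by `h 0 = 1` and omitting
a disc around `-1`. -/
lemma norm_le_of_omits_ball {h : ℂ → ℂ} (hh : DifferentiableOn ℂ h (ball 0 1)) (h0 : h 0 = 1)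
    (homit : ∀ z ∈ ball (0 : ℂ) 1, 2 / 5 ≤ ‖h z + 1‖) {z : ℂ} (hz : z ∈ ball (0 : ℂ) 1) :
    ‖h z‖ ≤ 1 + 2 * Real.exp (10 * ‖z‖ / (1 - ‖z‖)) := by
  obtain ⟨L, hLd, hL0, hL⟩ := exists_differentiableOn_exp_eq
    (g := fun z ↦ (h z + 1) / 2) ((hh.add_const 1).div_const 2)
    (fun z hz hzero ↦ by
      have := homit z hz
      have h2 : h z + 1 = 0 := by simpa using hzero
      rw [h2, norm_zero] at this
      norm_num at this) (by norm_num [h0])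
  have hre : MapsTo (fun z ↦ -L z) (ball 0 1) {z | z.re ≤ 5} := by
    intro w hw
    have h1 := homit w hw
    have h2 : Real.exp (L w).re = ‖h w + 1‖ / 2 := by
      rw [← Complex.norm_exp, hL w hw]; simp
    have h3 : Real.exp (-5) ≤ Real.exp (L w).re := by
      have h4 := Real.add_one_le_exp (5 : ℝ)
      have h5 : Real.exp (-5) * Real.exp 5 = 1 := by rw [← Real.exp_add]; simp
      have h6 := Real.exp_pos (-5)
      rw [h2]
      nlinarith
    have h4 := Real.exp_le_exp.1 h3
    simp only [mem_ofPred_eq, Complex.neg_re]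
    linarith
  have hB := Complex.borelCaratheodory_zero (by norm_num) hLd.neg hre one_pos hz (by simp [hL0])
  have h2 : ‖h z + 1‖ = 2 * Real.exp (L z).re := by
    rw [← Complex.norm_exp, hL z hz]; simp
    ring
  have h3 : (L z).re ≤ 10 * ‖z‖ / (1 - ‖z‖) := by
    refine (Complex.re_le_norm _).trans ?_
    rw [Pi.neg_apply, norm_neg] at hB
    norm_num at hB
    exact hB
  calc ‖h z‖ = ‖(h z + 1) - 1‖ := by rw [add_sub_cancel_right]
    _ ≤ ‖h z + 1‖ + ‖(1 : ℂ)‖ := norm_sub_le _ _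
    _ ≤ _ := by
      rw [h2, norm_one]
      have := Real.exp_le_exp.2 h3
      linarith

/-- A function on the disc whose square is injective and covers the unit disc around `1`
omits a disc around `-1`. -/
lemma omits_ball_of_sq_injOn {h : ℂ → ℂ} (hh : DifferentiableOn ℂ h (ball 0 1)) (h0 : h 0 = 1)
    (hne : ∀ z ∈ ball (0 : ℂ) 1, h z ≠ 0) (hi : InjOn (fun z ↦ h z ^ 2) (ball 0 1))
    (hcover : ball 1 1 ⊆ (fun z ↦ h z ^ 2) '' ball (0 : ℂ) 1) :
    ∀ z ∈ ball (0 : ℂ) 1, 2 / 5 ≤ ‖h z + 1‖ := by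
  have hinj : InjOn h (ball 0 1) := fun x hx y hy hxy ↦ hi hx hy (by simp [hxy])
  have hdisj : ∀ z ∈ ball (0 : ℂ) 1, ∀ w ∈ ball (0 : ℂ) 1, h z ≠ -h w := by
    intro z hz w hw hzw
    obtain rfl : z = w := hi hz hw (by simp [hzw])
    exact hne z hz (by linear_combination hzw / 2)
  have hopen := isOpen_image_of_injOn isOpen_ball hh hinj
  have hsub : ball (1 : ℂ) (2 / 5) ⊆ h '' ball 0 1 := by
    refine (convex_ball (1 : ℂ) (2 / 5)).isPreconnected.subset_left_of_subset_union hopen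
      (v := Neg.neg ⁻¹' (h '' ball 0 1)) (hopen.preimage continuous_neg) ?_ ?_
      ⟨1, mem_ball_self (by norm_num), 0, mem_ball_self one_pos, h0⟩
    · rw [disjoint_left]
      rintro _ ⟨z, hz, rfl⟩ ⟨w, hw, hzw⟩
      exact hdisj w hw z hz hzw
    · intro w hw
      have hw2 : w ^ 2 ∈ ball (1 : ℂ) 1 := by
        rw [mem_ball_iff_norm] at hw ⊢
        have h1 : ‖w + 1‖ ≤ ‖w - 1‖ + 2 := by
          calc ‖w + 1‖ = ‖(w - 1) + 2‖ := by ring_nf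
            _ ≤ ‖w - 1‖ + ‖(2 : ℂ)‖ := norm_add_le _ _
            _ = _ := by simp
        have h2 : w ^ 2 - 1 = (w - 1) * (w + 1) := by ring
        rw [h2, norm_mul]
        nlinarith [norm_nonneg (w - 1), norm_nonneg (w + 1)]
      obtain ⟨z, hz, hzw⟩ := hcover hw2
      rcases sq_eq_sq_iff_eq_or_eq_neg.1 hzw with h | h
      · exact Or.inl ⟨z, hz, h⟩
      · exact Or.inr ⟨z, hz, h⟩
  intro z hz
  by_contra! hlt
  obtain ⟨w, hw, hzw⟩ := hsub (show -h z ∈ ball (1 : ℂ) (2 / 5) by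
    rw [mem_ball_iff_norm, ← norm_neg]; simpa [add_comm] using hlt)
  exact hdisj w hw z hz hzw

/-- Growth bound for an injective holomorphic function on the disc, in terms of the modulus of an
omitted value closest to the origin. -/
lemma norm_le_of_injOn_of_omits {f : ℂ → ℂ} (hf : DifferentiableOn ℂ f (ball 0 1))
    (hi : InjOn f (ball 0 1)) (h0 : f 0 = 0) {c : ℂ} (hc : c ∉ f '' ball 0 1)
    (hcover : ball 0 ‖c‖ ⊆ f '' ball 0 1) {z : ℂ} (hz : z ∈ ball (0 : ℂ) 1) :
    ‖f z‖ ≤ ‖c‖ * (1 + (1 + 2 * Real.exp (10 * ‖z‖ / (1 - ‖z‖))) ^ 2) := by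
  have hc0 : c ≠ 0 := by
    rintro rfl
    exact hc ⟨0, mem_ball_self one_pos, h0⟩
  obtain ⟨L, hLd, hL0, hL⟩ := exists_differentiableOn_exp_eq (g := fun z ↦ 1 - f z / c)
    ((hf.div_const c).const_sub 1)
    (fun z hz hzero ↦ hc ⟨z, hz, by
      field_simp at hzero
      linear_combination -hzero⟩) (by simp [h0])
  set h : ℂ → ℂ := fun z ↦ Complex.exp (L z / 2) with hdef
  have hsq : ∀ z ∈ ball (0 : ℂ) 1, h z ^ 2 = 1 - f z / c := by
    intro z hz
    rw [← hL z hz, hdef, ← Complex.exp_nat_mul]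
    congr 1
    push_cast
    ring
  have hh : DifferentiableOn ℂ h (ball 0 1) := (hLd.div_const 2).cexp
  have hh0 : h 0 = 1 := by simp [hdef, hL0]
  have homit := omits_ball_of_sq_injOn hh hh0 (fun z _ ↦ Complex.exp_ne_zero _)
    (fun x hx y hy hxy ↦ hi hx hy (by
      simp only [hsq x hx, hsq y hy] at hxy
      field_simp at hxy
      linear_combination -hxy))
    (fun w hw ↦ by
      obtain ⟨x, hx, hxw⟩ := hcover (show c * (1 - w) ∈ ball (0 : ℂ) ‖c‖ by
        rw [mem_ball_iff_norm, norm_sub_rev] at hw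
        rw [mem_ball_zero_iff, norm_mul]
        exact mul_lt_of_lt_one_right (norm_pos_iff.2 hc0) hw)
      refine ⟨x, hx, ?_⟩
      simp only [hsq x hx, hxw]
      field_simp
      ring)
  have hb := norm_le_of_omits_ball hh hh0 homit hz
  have hfz : f z = c * (1 - h z ^ 2) := by
    rw [hsq z hz]
    field_simp
    ring
  rw [hfz, norm_mul]
  gcongr
  calc ‖1 - h z ^ 2‖ ≤ ‖(1 : ℂ)‖ + ‖h z ^ 2‖ := norm_sub_le _ _
    _ = 1 + ‖h z‖ ^ 2 := by simp
    _ ≤ _ := by gcongr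

/-- If the image of an injective holomorphic function on the disc contains a disc around the
origin, the radius of the latter is bounded by the Schwarz lemma for the inverse. -/
lemma radius_le_of_ball_subset_image {f : ℂ → ℂ} (hf : DifferentiableOn ℂ f (ball 0 1))
    (hi : InjOn f (ball 0 1)) (h0 : f 0 = 0) {a : ℂ} (ha : a ≠ 0) (ha1 : ‖a‖ < 1) {R : ℝ}
    (hR : ball 0 R ⊆ f '' ball 0 1) : R ≤ ‖f a‖ / ‖a‖ := by
  have hapos := norm_pos_iff.2 ha
  rcases le_or_gt R ‖f a‖ with hle | hlt
  · exact hle.trans (le_div_self (norm_nonneg _) hapos ha1.le)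
  have hRpos : 0 < R := (norm_nonneg _).trans_lt hlt
  have hleft : ∀ z ∈ ball (0 : ℂ) 1, Function.invFunOn f (ball 0 1) (f z) = z :=
    fun z hz ↦ hi.leftInvOn_invFunOn hz
  have hφ0 : Function.invFunOn f (ball 0 1) 0 = 0 := by
    simpa [h0] using hleft 0 (mem_ball_self one_pos)
  have hS := Complex.dist_le_div_mul_dist_of_mapsTo_ball (R₂ := 1)
    ((differentiableOn_invFunOn_of_injOn isOpen_ball hf hi).mono hR)
    (fun w hw ↦ by
      rw [hφ0]
      exact ball_subset_closedBall (Function.invFunOn_mem (hR hw)))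
    (mem_ball_zero_iff.2 hlt)
  rw [hφ0, hleft a (mem_ball_zero_iff.2 ha1), dist_zero_right, dist_zero_right] at hS
  rw [le_div_iff₀ hapos]
  rw [div_mul_eq_mul_div, one_mul, le_div_iff₀ hRpos] at hS
  linarith

/-- Locally uniform boundedness of the family of injective holomorphic functions on the unit
disc with the two prescribed values `f 0 = 0`, `f a = b`. -/
theorem stmt_6 (a b : ℂ) (ha : a ≠ 0) (hb : b ≠ 0) (ha1 : ‖a‖ < 1)
    (K : Set ℂ) (hK : IsCompact K) (hKD : K ⊆ ball (0 : ℂ) 1) :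
    ∃ M : ℝ, ∀ f : ℂ → ℂ, DifferentiableOn ℂ f (ball (0 : ℂ) 1) →
      Set.InjOn f (ball (0 : ℂ) 1) → f 0 = 0 → f a = b →
      ∀ z ∈ K, ‖f z‖ ≤ M := by
  obtain ⟨ρ, hρ, hKρ⟩ := exists_lt_subset_ball hK.isClosed hKD
  refine ⟨‖b‖ / ‖a‖ * (1 + (1 + 2 * Real.exp (10 * ρ / (1 - ρ))) ^ 2), ?_⟩
  rintro f hf hi h0 rfl z hz
  have hzρ : ‖z‖ < ρ := mem_ball_zero_iff.1 (hKρ hz)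
  have hradius {R : ℝ} (hR : ball 0 R ⊆ f '' ball 0 1) : R ≤ ‖f a‖ / ‖a‖ :=
    radius_le_of_ball_subset_image hf hi h0 ha ha1 hR
  have hne : (f '' ball 0 1)ᶜ.Nonempty := by
    rw [nonempty_compl]
    intro huniv
    have := hradius (R := ‖f a‖ / ‖a‖ + 1) (by simp [huniv])
    linarith
  obtain ⟨c, hc, hdist⟩ :=
    (isOpen_image_of_injOn isOpen_ball hf hi).isClosed_compl.exists_infDist_eq_dist hne 0
  rw [dist_zero_left] at hdist
  have hcover : ball 0 ‖c‖ ⊆ f '' ball 0 1 := hdist ▸ ball_infDist_compl_subset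
  refine (norm_le_of_injOn_of_omits hf hi h0 hc hcover (hKD hz)).trans ?_
  have h1ρ : 0 < 1 - ρ := by linarith
  have hρ0 : 0 ≤ ρ := (norm_nonneg z).trans hzρ.le
  have hcle := hradius hcover
  gcongr
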